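/- arXiv:2312.05549 — 3 statements merged into one kernel-verified Lean document; each statement's English description precedes it below -/
import Mathlib

section
/- Let d ≥ 1 and let C be a real d×d matrix, and set D = C ∘ C (the Hadamard square). Then C represents a DAG if and only if every eigenvalue of D is zero, i.e., every complex root of the characteristic polynomial of D equals 0 (equivalently, the characteristic polynomial of D is X^d). -/
/-- The Hadamard (entrywise) square of a matrix: `D i j = (C i j)^2`. -/
def hadamardSquare {d : ℕ} (C : Matrix (Fin d) (Fin d) ℝ) : Matrix (Fin d) (Fin d) ℝ :=
  Matrix.of fun i j => C i j ^ 2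

/-- `C` represents a DAG: the digraph with an edge `i → j` whenever `C i j ≠ 0`
contains no directed cycle. -/
def RepresentsDAG {d : ℕ} (C : Matrix (Fin d) (Fin d) ℝ) : Prop :=
  ¬ ∃ (s : ℕ) (f : ℕ → Fin d),
      1 ≤ s ∧ f s = f 0 ∧ ∀ k < s, C (f k) (f (k + 1)) ≠ 0

theorem aux_walk {d : ℕ} (C : Matrix (Fin d) (Fin d) ℝ) (n : ℕ) :
    ∀ i j, ((hadamardSquare C) ^ n) i j ≠ 0 →
      ∃ f : ℕ → Fin d, f 0 = i ∧ ∀ k < n, C (f k) (f (k + 1)) ≠ 0 := by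
  induction n with
  | zero => intro i j _; exact ⟨fun _ => i, rfl, by simp⟩
  | succ n ih =>
    intro i j h
    rw [pow_succ', Matrix.mul_apply] at h
    obtain ⟨l, -, hl⟩ := Finset.exists_ne_zero_of_sum_ne_zero h
    obtain ⟨f, hf0, hf⟩ := ih l j (right_ne_zero_of_mul hl)
    have hC : C i l ≠ 0 := by
      intro h0
      apply left_ne_zero_of_mul hl
      simp [hadamardSquare, h0]
    refine ⟨fun k => Nat.casesOn k i f, rfl, ?_⟩
    intro k hk
    cases k with
    | zero => simpa [hf0] using hC
    | succ k => exact hf k (by omega)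

theorem aux_nonneg {d : ℕ} (C : Matrix (Fin d) (Fin d) ℝ) (n : ℕ) :
    ∀ i j, 0 ≤ ((hadamardSquare C) ^ n) i j := by
  induction n with
  | zero => intro i j; rw [pow_zero, Matrix.one_apply]; split_ifs <;> simp
  | succ n ih =>
    intro i j
    rw [pow_succ, Matrix.mul_apply]
    exact Finset.sum_nonneg fun l _ => mul_nonneg (ih i l) (sq_nonneg (C l j))

theorem aux_mul_pos {d : ℕ} (C : Matrix (Fin d) (Fin d) ℝ) (m n : ℕ) (i l j : Fin d)
    (h1 : 0 < ((hadamardSquare C) ^ m) i l) (h2 : 0 < ((hadamardSquare C) ^ n) l j) :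
    0 < ((hadamardSquare C) ^ (m + n)) i j := by
  rw [pow_add, Matrix.mul_apply]
  exact Finset.sum_pos' (fun x _ => mul_nonneg (aux_nonneg C m i x) (aux_nonneg C n x j))
    ⟨l, Finset.mem_univ _, mul_pos h1 h2⟩

theorem aux_path_pos {d : ℕ} (C : Matrix (Fin d) (Fin d) ℝ) (f : ℕ → Fin d) (n : ℕ)
    (hf : ∀ k < n, C (f k) (f (k + 1)) ≠ 0) :
    0 < ((hadamardSquare C) ^ n) (f 0) (f n) := by
  induction n with
  | zero => simp
  | succ n ih =>
    refine aux_mul_pos C n 1 _ (f n) _ (ih fun k hk => hf k (by omega)) ?_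
    have := hf n (by omega)
    rw [pow_one]
    change 0 < C (f n) (f (n + 1)) ^ 2
    positivity

theorem aux_dag_iff {d : ℕ} (C : Matrix (Fin d) (Fin d) ℝ) :
    RepresentsDAG C ↔ (hadamardSquare C) ^ d = 0 := by
  constructor
  · intro h
    by_contra hne
    have : ∃ i j, ((hadamardSquare C) ^ d) i j ≠ 0 := by
      by_contra! h0
      exact hne (Matrix.ext h0)
    obtain ⟨i, j, hij⟩ := this
    obtain ⟨f, -, hf⟩ := aux_walk C d i j hij
    obtain ⟨a, b, hab, hfab⟩ : ∃ a b : Fin (d + 1), a < b ∧ f a = f b := by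
      obtain ⟨a, b, hab, hfab⟩ := Fintype.exists_ne_map_eq_of_card_lt
        (fun k : Fin (d + 1) => f k) (by simp)
      rcases lt_or_gt_of_ne hab with h | h
      · exact ⟨a, b, h, hfab⟩
      · exact ⟨b, a, h, hfab.symm⟩
    have hab' : (a : ℕ) < b := hab
    have hb := b.2
    refine h ⟨b - a, fun k => f (a + k), by omega, ?_, ?_⟩
    · simp only [add_zero]
      rw [hfab]
      congr 1
      omega
    · intro k hk
      exact hf (a + k) (by omega)
  · rintro h ⟨s, f, hs, hfs, hf⟩
    have h1 := aux_path_pos C f s hf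
    rw [hfs] at h1
    have h2 : ∀ m : ℕ, 0 < ((hadamardSquare C) ^ (m * s)) (f 0) (f 0) := by
      intro m
      induction m with
      | zero => simp
      | succ m ih =>
        rw [Nat.succ_mul]
        exact aux_mul_pos C _ _ _ (f 0) _ ih h1
    have h3 := h2 d
    rw [pow_mul, h, zero_pow (by omega)] at h3
    simp at h3

theorem aux_charpoly {d : ℕ} (C : Matrix (Fin d) (Fin d) ℝ) :
    RepresentsDAG C ↔
      ((hadamardSquare C).map (Complex.ofReal ·)).charpoly = Polynomial.X ^ d := by
  have hM : (hadamardSquare C).map (Complex.ofReal ·) =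
    (hadamardSquare C).map Complex.ofRealHom := rfl
  rw [aux_dag_iff, hM, Matrix.charpoly_map]
  have hX : (Polynomial.X ^ d : Polynomial ℂ) =
      (Polynomial.X ^ d : Polynomial ℝ).map Complex.ofRealHom := by simp
  rw [hX, (Polynomial.map_injective _ Complex.ofRealHom.injective).eq_iff]
  constructor
  · intro h
    have := Matrix.isNilpotent_charpoly_sub_pow_of_isNilpotent (M := hadamardSquare C) ⟨d, h⟩
    rw [Fintype.card_fin] at this
    exact sub_eq_zero.mp this.eq_zero
  · intro h
    have := Matrix.aeval_self_charpoly (hadamardSquare C)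
    rw [h] at this
    simpa using this

theorem representsDAG_iff_eigenvalues_zero
    {d : ℕ} (hd : 1 ≤ d) (C : Matrix (Fin d) (Fin d) ℝ) :
    (RepresentsDAG C ↔
        ∀ μ ∈ ((hadamardSquare C).map (Complex.ofReal ·)).charpoly.roots, μ = 0) ∧
    (RepresentsDAG C ↔
        ((hadamardSquare C).map (Complex.ofReal ·)).charpoly = Polynomial.X ^ d) := by
  refine ⟨?_, aux_charpoly C⟩
  rw [aux_charpoly C]
  set M := (hadamardSquare C).map (Complex.ofReal ·) with hM
  constructor
  · intro h μ hμ
    rw [h, Polynomial.roots_X_pow] at hμ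
    simpa using Multiset.mem_of_mem_nsmul hμ
  · intro h
    have hs := IsAlgClosed.splits M.charpoly
    have hc : M.charpoly.roots.card = d := by
      rw [← hs.natDegree_eq_card_roots, Matrix.charpoly_natDegree_eq_dim, Fintype.card_fin]
    have hr : M.charpoly.roots = Multiset.replicate d 0 := Multiset.eq_replicate.mpr ⟨hc, h⟩
    have := hs.eq_prod_roots_of_monic (Matrix.charpoly_monic M)
    rw [hr] at this
    simpa using this
end

section
/- Let d ≥ 1 and let C be a real d×d matrix, and set D = C ∘ C (the Hadamard square). Then C represents a DAG if and only if tr(D^s) = 0 for every integer s with 1 ≤ s ≤ d. -/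
theorem hsq_pow_nonneg {d : ℕ} (C : Matrix (Fin d) (Fin d) ℝ) (s : ℕ) :
    ∀ i j, 0 ≤ (hadamardSquare C ^ s) i j := by
  induction s with
  | zero =>
    intro i j
    rw [pow_zero, Matrix.one_apply]
    split_ifs <;> norm_num
  | succ n ih =>
    intro i j
    rw [pow_succ, Matrix.mul_apply]
    exact Finset.sum_nonneg fun k _ => mul_nonneg (ih i k) (sq_nonneg (C k j))

theorem hsq_pow_ne_zero_of_walk {d : ℕ} (C : Matrix (Fin d) (Fin d) ℝ) (f : ℕ → Fin d) (s : ℕ)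
    (h : ∀ k < s, C (f k) (f (k + 1)) ≠ 0) : 0 < (hadamardSquare C ^ s) (f 0) (f s) := by
  induction s with
  | zero => simp
  | succ n ih =>
    rw [pow_succ, Matrix.mul_apply]
    refine Finset.sum_pos' (fun k _ => mul_nonneg (hsq_pow_nonneg C n _ k) (sq_nonneg (C k _)))
      ⟨f n, Finset.mem_univ _, ?_⟩
    refine mul_pos (ih fun k hk => h k (by omega)) ?_
    have := h n (by omega)
    change 0 < C (f n) (f (n + 1)) ^ 2
    positivity

theorem walk_of_hsq_pow_ne_zero {d : ℕ} (C : Matrix (Fin d) (Fin d) ℝ) (s : ℕ) :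
    ∀ i j, (hadamardSquare C ^ s) i j ≠ 0 →
      ∃ f : ℕ → Fin d, f 0 = i ∧ f s = j ∧ ∀ k < s, C (f k) (f (k + 1)) ≠ 0 := by
  induction s with
  | zero =>
    intro i j h
    rw [pow_zero, Matrix.one_apply] at h
    have hij : i = j := by
      by_contra hne
      simp [hne] at h
    exact ⟨fun _ => i, rfl, hij, fun k hk => by omega⟩
  | succ n ih =>
    intro i j h
    rw [pow_succ', Matrix.mul_apply] at h
    obtain ⟨m, -, hm⟩ := Finset.exists_ne_zero_of_sum_ne_zero h
    obtain ⟨f, h0, hn, hf⟩ := ih m j (right_ne_zero_of_mul hm)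
    have hC : C i m ≠ 0 := by
      intro h0
      apply left_ne_zero_of_mul hm
      simp [hadamardSquare, h0]
    refine ⟨fun k => Nat.casesOn k i f, rfl, hn, ?_⟩
    intro k hk
    cases k with
    | zero => simpa [h0] using hC
    | succ k => exact hf k (by omega)

theorem representsDAG_iff_trace_pow_eq_zero
    {d : ℕ} (hd : 1 ≤ d) (C : Matrix (Fin d) (Fin d) ℝ) :
    RepresentsDAG C ↔
      ∀ s : ℕ, 1 ≤ s → s ≤ d → Matrix.trace (hadamardSquare C ^ s) = 0 := by
  constructor
  · intro h s hs _
    by_contra hne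
    obtain ⟨i, -, hi⟩ := Finset.exists_ne_zero_of_sum_ne_zero hne
    obtain ⟨f, h0, hn, hf⟩ := walk_of_hsq_pow_ne_zero C s i i hi
    exact h ⟨s, f, hs, hn.trans h0.symm, hf⟩
  · rintro h ⟨s, hs⟩
    induction s using Nat.strong_induction_on with
    | _ s ih =>
    obtain ⟨f, hs, hc, hf⟩ := hs
    by_cases hsd : s ≤ d
    · have hp := hsq_pow_ne_zero_of_walk C f s hf
      rw [hc] at hp
      have : 0 < Matrix.trace (hadamardSquare C ^ s) :=
        Finset.sum_pos' (fun i _ => hsq_pow_nonneg C s i i) ⟨f 0, Finset.mem_univ _, hp⟩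
      exact this.ne' (h s hs hsd)
    · obtain ⟨a, b, hab, hfab⟩ := Fintype.exists_ne_map_eq_of_card_lt
        (fun k : Fin s => f k) (by simpa using hsd)
      have key : ∀ a b : Fin s, a < b → f a = f b → False := by
        intro a b hab hfab
        have hab' : (a : ℕ) < b := hab
        have hb := b.2
        refine ih (b - a) (by omega) ⟨fun k => f (a + k), by omega, ?_, fun k hk => ?_⟩
        · change f (a + (b - a)) = f (a + 0)
          rw [Nat.add_sub_cancel' hab'.le, add_zero, hfab]
        · exact hf (a + k) (by omega)
      rcases lt_or_gt_of_ne hab with h1 | h1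
      · exact key a b h1 hfab
      · exact key b a h1 hfab.symm
end

section
/- Let d ≥ 1 and let C be a real d×d matrix, and set D = C ∘ C (the Hadamard square). Then C represents a DAG if and only if D is nilpotent, and this holds if and only if D^d = 0. -/
theorem hs_pow_nonneg {d : ℕ} (C : Matrix (Fin d) (Fin d) ℝ) (n : ℕ) :
    ∀ i j, 0 ≤ (hadamardSquare C ^ n) i j := by
  induction n with
  | zero =>
    intro i j
    rw [pow_zero, Matrix.one_apply]
    split_ifs <;> norm_num
  | succ n ih =>
    intro i j
    rw [pow_succ, Matrix.mul_apply]
    exact Finset.sum_nonneg fun k _ => mul_nonneg (ih i k) (sq_nonneg (C k j))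

theorem exists_walk_of_pow_ne_zero {d : ℕ} (C : Matrix (Fin d) (Fin d) ℝ) (n : ℕ) :
    ∀ i j, (hadamardSquare C ^ n) i j ≠ 0 →
      ∃ f : ℕ → Fin d, f 0 = i ∧ f n = j ∧ ∀ k < n, C (f k) (f (k + 1)) ≠ 0 := by
  induction n with
  | zero =>
    intro i j h
    rw [pow_zero, Matrix.one_apply] at h
    have hij : i = j := by
      by_contra hne
      simp [hne] at h
    exact ⟨fun _ => i, rfl, hij, by simp⟩
  | succ n ih =>
    intro i j h
    rw [pow_succ', Matrix.mul_apply] at h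
    obtain ⟨k, -, hk⟩ := Finset.exists_ne_zero_of_sum_ne_zero h
    obtain ⟨f, h0, hn, hf⟩ := ih k j (right_ne_zero_of_mul hk)
    have hC : C i k ≠ 0 := by
      have h1 : C i k ^ 2 ≠ 0 := left_ne_zero_of_mul hk
      intro h2
      simp [h2] at h1
    refine ⟨fun m => Nat.casesOn m i f, rfl, hn, ?_⟩
    intro m hm
    cases m with
    | zero => simpa [h0] using hC
    | succ m => exact hf m (by omega)

theorem pow_pos_of_walk {d : ℕ} (C : Matrix (Fin d) (Fin d) ℝ) (f : ℕ → Fin d) (n : ℕ)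
    (hf : ∀ k < n, C (f k) (f (k + 1)) ≠ 0) : 0 < (hadamardSquare C ^ n) (f 0) (f n) := by
  induction n with
  | zero => simp
  | succ n ih =>
    rw [pow_succ, Matrix.mul_apply]
    refine Finset.sum_pos' (fun k _ => mul_nonneg (hs_pow_nonneg C n _ k) (sq_nonneg (C k _)))
      ⟨f n, Finset.mem_univ _, mul_pos (ih fun k hk => hf k (by omega)) ?_⟩
    exact sq_pos_of_ne_zero (hf n (by omega))

theorem pow_eq_zero_of_dag {d : ℕ} (C : Matrix (Fin d) (Fin d) ℝ) (h : RepresentsDAG C) :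
    hadamardSquare C ^ d = 0 := by
  ext i j
  by_contra hne
  obtain ⟨f, -, -, hf⟩ := exists_walk_of_pow_ne_zero C d i j hne
  obtain ⟨a, b, hab, hfab⟩ :=
    Fintype.exists_ne_map_eq_of_card_lt (fun k : Fin (d + 1) => f k) (by simp)
  have key : ∀ a b : ℕ, a < b → b ≤ d → f a = f b → False := by
    intro a b hab hb e
    refine h ⟨b - a, fun k => f (a + k), by omega, ?_, ?_⟩
    · simp only [Nat.add_sub_cancel' hab.le, add_zero]
      exact e.symm
    · intro k hk
      exact hf (a + k) (by omega)
  rcases lt_or_gt_of_ne hab with hlt | hlt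
  · exact key a b hlt (by omega) hfab
  · exact key b a hlt (by omega) hfab.symm

theorem dag_of_nilpotent {d : ℕ} (C : Matrix (Fin d) (Fin d) ℝ)
    (h : IsNilpotent (hadamardSquare C)) : RepresentsDAG C := by
  rintro ⟨s, f, hs, hfs, hf⟩
  obtain ⟨n, hn⟩ := h
  have hp := pow_pos_of_walk C (fun k => f (k % s)) n (by
    intro k _
    have hlt : k % s < s := Nat.mod_lt _ hs
    have e : f ((k + 1) % s) = f (k % s + 1) := by
      rw [← Nat.mod_add_mod]
      rcases Nat.lt_or_ge (k % s + 1) s with h1 | h1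
      · rw [Nat.mod_eq_of_lt h1]
      · have h2 : k % s + 1 = s := by omega
        rw [h2, Nat.mod_self, hfs]
    simp only [e]
    exact hf _ hlt)
  rw [hn] at hp
  simp at hp

theorem representsDAG_iff_nilpotent
    {d : ℕ} (hd : 1 ≤ d) (C : Matrix (Fin d) (Fin d) ℝ) :
    (RepresentsDAG C ↔ IsNilpotent (hadamardSquare C)) ∧
    (RepresentsDAG C ↔ hadamardSquare C ^ d = 0) := by
  exact ⟨⟨fun h => ⟨d, pow_eq_zero_of_dag C h⟩, dag_of_nilpotent C⟩,
    ⟨pow_eq_zero_of_dag C, fun h => dag_of_nilpotent C ⟨d, h⟩⟩⟩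
end
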